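/- Let V be a complex Banach space, m ∈ ℝ, ρ ∈ ℝ with −1 < ρ ≤ 1, and F ∈ S^{m,ρ}(ℝ^{2n}, V). Then there exists a unique element I(F) ∈ V such that for every compactly supported smooth χ : ℝ^{2n} → ℝ which equals 1 on some open neighborhood of (0,0), and for every (p₀,x₀) ∈ ℝ^{2n}, the Bochner integrals (2π)^{−n} ∫_{ℝ^{2n}} e^{i⟨p,x⟩} χ(ε(p−p₀), ε(x−x₀)) F(p,x) dp dx converge to I(F) as ε → 0⁺. In particular, the limit exists and is independent of the choice of cutoff χ and of the center (p₀,x₀). -/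

import Mathlib

open Filter MeasureTheory

noncomputable def pder {n : ℕ} {V : Type*} [NormedAddCommGroup V] [NormedSpace ℝ V]
    (i : Fin n) (f : (Fin n → ℝ) → V) : (Fin n → ℝ) → V :=
  fun x => fderiv ℝ f x (Pi.single i 1)

noncomputable def mder {n : ℕ} {V : Type*} [NormedAddCommGroup V] [NormedSpace ℝ V]
    (μ : Fin n → ℕ) (f : (Fin n → ℝ) → V) : (Fin n → ℝ) → V :=
  (List.finRange n).foldr (fun i g => (pder i)^[μ i] g) f

def mOrder {n : ℕ} (μ : Fin n → ℕ) : ℕ := ∑ i, μ i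

noncomputable def symWt {n : ℕ} (m ρ : ℝ) (μ : Fin n → ℕ) (x : Fin n → ℝ) : ℝ :=
  (1 + ‖x‖ ^ 2) ^ (-(m - ρ * (mOrder μ : ℝ)) / 2)

noncomputable def symNorm {n : ℕ} {V : Type*} [NormedAddCommGroup V] [NormedSpace ℝ V]
    (m ρ : ℝ) (μ : Fin n → ℕ) (F : (Fin n → ℝ) → V) : ℝ :=
  ⨆ x : Fin n → ℝ, symWt m ρ μ x * ‖mder μ F x‖

def IsSymbol {n : ℕ} {V : Type*} [NormedAddCommGroup V] [NormedSpace ℝ V]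
    (m ρ : ℝ) (F : (Fin n → ℝ) → V) : Prop :=
  ContDiff ℝ (⊤ : ℕ∞) F ∧ ∀ μ : Fin n → ℕ, ∃ C : ℝ, ∀ x, symWt m ρ μ x * ‖mder μ F x‖ ≤ C
def fstHalf {n : ℕ} (z : Fin (n + n) → ℝ) : Fin n → ℝ := fun i => z (Fin.castAdd n i)

def sndHalf {n : ℕ} (z : Fin (n + n) → ℝ) : Fin n → ℝ := fun i => z (Fin.natAdd n i)

noncomputable def pairM {n : ℕ} (M : Matrix (Fin n) (Fin n) ℝ) (p x : Fin n → ℝ) : ℝ :=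
  ∑ i, p i * M.mulVec x i

noncomputable def phase {n : ℕ} (M : Matrix (Fin n) (Fin n) ℝ) (z : Fin (n + n) → ℝ) : ℂ :=
  Complex.exp (Complex.I * (pairM M (fstHalf z) (sndHalf z) : ℂ))

noncomputable def cutInt {n : ℕ} {V : Type*} [NormedAddCommGroup V] [NormedSpace ℝ V]
    [NormedSpace ℂ V] [IsScalarTower ℝ ℂ V] (M : Matrix (Fin n) (Fin n) ℝ)
    (χ : (Fin (n + n) → ℝ) → ℝ) (z₀ : Fin (n + n) → ℝ) (ε : ℝ)
    (F : (Fin (n + n) → ℝ) → V) : V :=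
  ((2 * Real.pi) ^ n)⁻¹ • ∫ z : Fin (n + n) → ℝ, χ (ε • (z - z₀)) • (phase M z • F z)

def IsOscInt {n : ℕ} {V : Type*} [NormedAddCommGroup V] [NormedSpace ℝ V]
    [NormedSpace ℂ V] [IsScalarTower ℝ ℂ V] (M : Matrix (Fin n) (Fin n) ℝ)
    (F : (Fin (n + n) → ℝ) → V) (v : V) : Prop :=
  ∀ χ : (Fin (n + n) → ℝ) → ℝ, ContDiff ℝ (⊤ : ℕ∞) χ → HasCompactSupport χ →
    (∀ᶠ z in nhds (0 : Fin (n + n) → ℝ), χ z = 1) →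
    ∀ z₀ : Fin (n + n) → ℝ,
      Filter.Tendsto (fun ε : ℝ => cutInt M χ z₀ ε F) (nhdsWithin 0 (Set.Ioi 0)) (nhds v)

open Classical in
noncomputable def oscInt {n : ℕ} {V : Type*} [NormedAddCommGroup V] [NormedSpace ℝ V]
    [NormedSpace ℂ V] [IsScalarTower ℝ ℂ V] (M : Matrix (Fin n) (Fin n) ℝ)
    (F : (Fin (n + n) → ℝ) → V) : V :=
  if h : ∃ v, IsOscInt M F v then h.choose else 0

open scoped ContDiff Topology

lemma one_le_one_add_norm_sq {E : Type*} [NormedAddCommGroup E] (z : E) : 1 ≤ 1 + ‖z‖ ^ 2 := by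
  nlinarith [sq_nonneg ‖z‖]

section SymbolFamilies

variable {ι E W : Type*} [NormedAddCommGroup E] [NormedSpace ℝ E]
  [NormedAddCommGroup W] [NormedSpace ℝ W] {l : Filter ι}

/-- A family of smooth functions satisfying, eventually along `l` and with uniform constants, the
symbol estimates of order `m` and type `ρ` for the derivatives of order at most `K`. -/
def SymbolFamily (l : Filter ι) (K : ℕ) (m ρ : ℝ) (F : ι → E → W) : Prop :=
  (∀ a, ContDiff ℝ ∞ (F a)) ∧ ∀ k ≤ K, ∃ C : ℝ, 0 ≤ C ∧ ∀ᶠ a in l, ∀ z,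
    ‖iteratedFDeriv ℝ k (F a) z‖ ≤ C * (1 + ‖z‖ ^ 2) ^ ((m - ρ * k) / 2)

lemma SymbolFamily.of_le {K : ℕ} {m ρ : ℝ} {F : ι → E → W} (h : SymbolFamily l K m ρ F)
    {K' : ℕ} {m' ρ' : ℝ} (hK : K' ≤ K) (hm : m ≤ m') (hρ : ρ' ≤ ρ) :
    SymbolFamily l K' m' ρ' F := by
  refine ⟨h.1, fun k hk => ?_⟩
  obtain ⟨C, hC, hb⟩ := h.2 k (hk.trans hK)
  refine ⟨C, hC, hb.mono fun a ha z => (ha z).trans ?_⟩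
  gcongr
  exact one_le_one_add_norm_sq z

lemma SymbolFamily.add {K : ℕ} {m ρ : ℝ} {F G : ι → E → W} (hF : SymbolFamily l K m ρ F)
    (hG : SymbolFamily l K m ρ G) : SymbolFamily l K m ρ (fun a z => F a z + G a z) := by
  refine ⟨fun a => (hF.1 a).add (hG.1 a), fun k hk => ?_⟩
  obtain ⟨C, hC, hb⟩ := hF.2 k hk
  obtain ⟨D, hD, hc⟩ := hG.2 k hk
  refine ⟨C + D, by positivity, ?_⟩
  filter_upwards [hb, hc] with a ha ha' z
  have e : iteratedFDeriv ℝ k (fun z => F a z + G a z) z =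
      iteratedFDeriv ℝ k (F a) z + iteratedFDeriv ℝ k (G a) z :=
    iteratedFDeriv_add_apply ((hF.1 a).of_le (mod_cast le_top)).contDiffAt
      ((hG.1 a).of_le (mod_cast le_top)).contDiffAt
  rw [e, add_mul]
  exact (norm_add_le _ _).trans (add_le_add (ha z) (ha' z))

lemma SymbolFamily.const {K : ℕ} {ρ : ℝ} (c : W) :
    SymbolFamily l K 0 ρ (fun (_ : ι) (_ : E) => c) := by
  refine ⟨fun _ => contDiff_const, fun k _ => ⟨‖c‖, norm_nonneg _, .of_forall fun _ z => ?_⟩⟩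
  rcases eq_or_ne k 0 with rfl | hk
  · simp
  · rw [iteratedFDeriv_const_of_ne hk]
    simp only [Pi.zero_apply, norm_zero]
    positivity

lemma SymbolFamily.zero {K : ℕ} {m ρ : ℝ} :
    SymbolFamily l K m ρ (fun (_ : ι) (_ : E) => (0 : W)) := by
  refine ⟨fun _ => contDiff_const, fun k _ => ⟨0, le_rfl, .of_forall fun _ z => ?_⟩⟩
  rw [iteratedFDeriv_fun_zero]
  simp

lemma SymbolFamily.sum {κ : Type*} {K : ℕ} {m ρ : ℝ} {F : κ → ι → E → W} (s : Finset κ)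
    (h : ∀ i, SymbolFamily l K m ρ (F i)) :
    SymbolFamily l K m ρ (fun a z => ∑ i ∈ s, F i a z) := by
  classical
  induction s using Finset.induction_on with
  | empty => simpa using SymbolFamily.zero
  | insert i s hi ih =>
    simp only [Finset.sum_insert hi]
    exact (h i).add ih

lemma SymbolFamily.clm_comp {W' : Type*} [NormedAddCommGroup W'] [NormedSpace ℝ W'] {K : ℕ}
    {m ρ : ℝ} {F : ι → E → W} (hF : SymbolFamily l K m ρ F) (L : W →L[ℝ] W') :
    SymbolFamily l K m ρ (fun a z => L (F a z)) := by
  refine ⟨fun a => L.contDiff.comp (hF.1 a), fun k hk => ?_⟩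
  obtain ⟨C, hC, hb⟩ := hF.2 k hk
  refine ⟨‖L‖ * C, by positivity, hb.mono fun a ha z => ?_⟩
  refine (L.norm_iteratedFDeriv_comp_left (hF.1 a).contDiffAt (mod_cast le_top)).trans ?_
  rw [mul_assoc]
  gcongr
  exact ha z

lemma SymbolFamily.smul {K : ℕ} {m m' ρ : ℝ} {f : ι → E → ℝ} {F : ι → E → W}
    (hf : SymbolFamily l K m ρ f) (hF : SymbolFamily l K m' ρ F) :
    SymbolFamily l K (m + m') ρ (fun a z => f a z • F a z) := by
  refine ⟨fun a => (hf.1 a).smul (hF.1 a), fun k hk => ?_⟩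
  have h1 : ∀ i : ℕ, ∃ C : ℝ, 0 ≤ C ∧ (i ≤ k → ∀ᶠ a in l, ∀ z,
      ‖iteratedFDeriv ℝ i (f a) z‖ ≤ C * (1 + ‖z‖ ^ 2) ^ ((m - ρ * i) / 2)) := fun i => by
    by_cases hi : i ≤ k
    · obtain ⟨C, hC, h⟩ := hf.2 i (hi.trans hk)
      exact ⟨C, hC, fun _ => h⟩
    · exact ⟨0, le_rfl, fun h => absurd h hi⟩
  have h2 : ∀ i : ℕ, ∃ C : ℝ, 0 ≤ C ∧ (i ≤ k → ∀ᶠ a in l, ∀ z,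
      ‖iteratedFDeriv ℝ i (F a) z‖ ≤ C * (1 + ‖z‖ ^ 2) ^ ((m' - ρ * i) / 2)) := fun i => by
    by_cases hi : i ≤ k
    · obtain ⟨C, hC, h⟩ := hF.2 i (hi.trans hk)
      exact ⟨C, hC, fun _ => h⟩
    · exact ⟨0, le_rfl, fun h => absurd h hi⟩
  choose C hC hb using h1
  choose D hD hc using h2
  refine ⟨∑ i ∈ Finset.range (k + 1), (k.choose i : ℝ) * C i * D (k - i),
    Finset.sum_nonneg fun i _ => by have := hC i; have := hD (k - i); positivity, ?_⟩
  have hb' : ∀ᶠ a in l, ∀ i ∈ Finset.range (k + 1), ∀ z,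
      ‖iteratedFDeriv ℝ i (f a) z‖ ≤ C i * (1 + ‖z‖ ^ 2) ^ ((m - ρ * i) / 2) :=
    (Filter.eventually_all_finset _).2 fun i hi =>
      hb i (Nat.lt_succ_iff.1 (Finset.mem_range.1 hi))
  have hc' : ∀ᶠ a in l, ∀ i ∈ Finset.range (k + 1), ∀ z,
      ‖iteratedFDeriv ℝ (k - i) (F a) z‖ ≤
        D (k - i) * (1 + ‖z‖ ^ 2) ^ ((m' - ρ * (k - i : ℕ)) / 2) :=
    (Filter.eventually_all_finset _).2 fun i _ => hc (k - i) (Nat.sub_le _ _)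
  filter_upwards [hb', hc'] with a ha ha' z
  refine (norm_iteratedFDeriv_smul_le (hf.1 a) (hF.1 a) z (mod_cast le_top)).trans ?_
  rw [Finset.sum_mul]
  refine Finset.sum_le_sum fun i hi => ?_
  have hik : i ≤ k := Nat.lt_succ_iff.1 (Finset.mem_range.1 hi)
  have hpos : (0 : ℝ) < 1 + ‖z‖ ^ 2 := by positivity
  have hexp : (1 + ‖z‖ ^ 2) ^ ((m + m' - ρ * k) / 2) =
      (1 + ‖z‖ ^ 2) ^ ((m - ρ * i) / 2) * (1 + ‖z‖ ^ 2) ^ ((m' - ρ * (k - i : ℕ)) / 2) := by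
    rw [← Real.rpow_add hpos]
    congr 1
    push_cast [hik]
    ring
  calc _ ≤ (k.choose i : ℝ) * (C i * (1 + ‖z‖ ^ 2) ^ ((m - ρ * i) / 2)) *
        (D (k - i) * (1 + ‖z‖ ^ 2) ^ ((m' - ρ * (k - i : ℕ)) / 2)) := by
        have := hC i
        gcongr
        · exact ha i hi z
        · exact ha' i hi z
    _ = _ := by rw [hexp]; ring

lemma SymbolFamily.fderiv {K : ℕ} {m ρ : ℝ} {F : ι → E → W} (h : SymbolFamily l (K + 1) m ρ F) :
    SymbolFamily l K (m - ρ) ρ (fun a => fderiv ℝ (F a)) := by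
  refine ⟨fun a => (h.1 a).fderiv_right (by simp), fun k hk => ?_⟩
  obtain ⟨C, hC, hb⟩ := h.2 (k + 1) (by omega)
  refine ⟨C, hC, hb.mono fun a ha z => ?_⟩
  rw [norm_iteratedFDeriv_fderiv]
  refine (ha z).trans_eq ?_
  push_cast
  ring_nf

lemma SymbolFamily.of_norm_le {m ρ : ℝ} {F : ι → E → W} (hs : ∀ a, ContDiff ℝ ∞ (F a))
    {C : ℝ} (h0 : ∀ᶠ a in l, ∀ z, ‖F a z‖ ≤ C * (1 + ‖z‖ ^ 2) ^ (m / 2)) :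
    SymbolFamily l 0 m ρ F := by
  refine ⟨hs, fun k hk => ⟨|C|, abs_nonneg _, h0.mono fun a ha z => ?_⟩⟩
  obtain rfl := Nat.le_zero.1 hk
  simp only [norm_iteratedFDeriv_zero, CharP.cast_eq_zero, mul_zero, sub_zero]
  exact (ha z).trans (by gcongr; exact le_abs_self C)

lemma SymbolFamily.of_fderiv {K : ℕ} {m ρ : ℝ} {F : ι → E → W} (hs : ∀ a, ContDiff ℝ ∞ (F a))
    {C : ℝ} (h0 : ∀ᶠ a in l, ∀ z, ‖F a z‖ ≤ C * (1 + ‖z‖ ^ 2) ^ (m / 2))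
    (h : SymbolFamily l K (m - ρ) ρ (fun a => _root_.fderiv ℝ (F a))) :
    SymbolFamily l (K + 1) m ρ F := by
  refine ⟨hs, fun k hk => ?_⟩
  rcases k with _ | k
  · exact (SymbolFamily.of_norm_le hs h0).2 0 le_rfl
  · obtain ⟨D, hD, hb⟩ := h.2 k (by omega)
    refine ⟨D, hD, hb.mono fun a ha z => ?_⟩
    rw [← norm_iteratedFDeriv_fderiv]
    refine (ha z).trans_eq ?_
    push_cast
    ring_nf

lemma SymbolFamily.clm {K : ℕ} (L : E →L[ℝ] W) :
    SymbolFamily l K 1 1 (fun (_ : ι) (z : E) => L z) := by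
  refine SymbolFamily.of_le (K := K + 1) ?_ (Nat.le_succ K) le_rfl le_rfl
  refine SymbolFamily.of_fderiv (C := ‖L‖) (fun _ => L.contDiff)
    (.of_forall fun _ z => (L.le_opNorm z).trans ?_) ?_
  · gcongr
    rw [← Real.sqrt_eq_rpow]
    exact Real.le_sqrt_of_sq_le (by linarith)
  · have : (fun (_ : ι) => _root_.fderiv ℝ (fun z : E => L z)) = fun _ _ => L := by
      ext; simp
    rw [this, sub_self]
    exact SymbolFamily.const L

/-- The reciprocal of an elliptic symbol of order `2` and type `1` is a symbol of order `-2`. -/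
lemma SymbolFamily.inv {q : E → ℝ} (hq : ∀ K, SymbolFamily l K 2 1 (fun _ : ι => q))
    {c : ℝ} (hc : 0 < c) (hqc : ∀ z, c * (1 + ‖z‖ ^ 2) ≤ q z) (K : ℕ) :
    SymbolFamily l K (-2) 1 (fun (_ : ι) z => (q z)⁻¹) := by
  have hpos : ∀ z, 0 < q z := fun z => lt_of_lt_of_le (by positivity) (hqc z)
  have hs : ∀ _ : ι, ContDiff ℝ ∞ (fun z => (q z)⁻¹) := fun a =>
    ((hq 0).1 a).inv fun z => (hpos z).ne'
  have h0 : ∀ᶠ _ in l, ∀ z, ‖(q z)⁻¹‖ ≤ c⁻¹ * (1 + ‖z‖ ^ 2) ^ ((-2 : ℝ) / 2) :=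
    .of_forall fun _ z => by
      rw [norm_inv, Real.norm_of_nonneg (hpos z).le, show (-2 : ℝ) / 2 = -1 by norm_num,
        Real.rpow_neg_one, ← mul_inv]
      exact inv_anti₀ (by positivity) (hqc z)
  induction K with
  | zero => exact SymbolFamily.of_norm_le hs h0
  | succ K ih =>
    refine SymbolFamily.of_fderiv hs h0 ?_
    have key := ((ih.smul ih).smul (hq (K + 1)).fderiv).clm_comp
      (-ContinuousLinearMap.id ℝ (E →L[ℝ] ℝ))
    refine ⟨fun a => (hs a).fderiv_right (by simp), ?_⟩
    rcases isEmpty_or_nonempty ι with hι | ⟨⟨a₀⟩⟩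
    · exact fun k _ => ⟨0, le_rfl, .of_forall fun a => (hι.false a).elim⟩
    have hd : ∀ z, DifferentiableAt ℝ q z := fun z =>
      ((hq 0).1 a₀).differentiable (by simp) z
    have e : ∀ z, _root_.fderiv ℝ (fun z => (q z)⁻¹) z =
        (-ContinuousLinearMap.id ℝ (E →L[ℝ] ℝ))
          (((q z)⁻¹ • (q z)⁻¹) • _root_.fderiv ℝ q z) := fun z => by
      have h1 : HasFDerivAt (fun z => (q z)⁻¹) (-(q z ^ 2)⁻¹ • _root_.fderiv ℝ q z) z :=
        (hasDerivAt_inv (hpos z).ne').comp_hasFDerivAt z (hd z).hasFDerivAt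
      rw [h1.fderiv]
      ext v
      simp [pow_two]
    have e' : (fun (_ : ι) => _root_.fderiv ℝ (fun z => (q z)⁻¹)) = fun _ z =>
        (-ContinuousLinearMap.id ℝ (E →L[ℝ] ℝ))
          (((q z)⁻¹ • (q z)⁻¹) • _root_.fderiv ℝ q z) := by
      ext1; ext1 z; exact e z
    rw [e']
    exact (key.of_le le_rfl (by norm_num) le_rfl).2

end SymbolFamilies

section PartialDerivatives

variable {d : ℕ} {V : Type*} [NormedAddCommGroup V] [NormedSpace ℝ V] {f : (Fin d → ℝ) → V}

lemma ContDiff.pder (hf : ContDiff ℝ ∞ f) (i : Fin d) : ContDiff ℝ ∞ (pder i f) :=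
  (hf.fderiv_right (by simp)).clm_apply contDiff_const

lemma ContDiff.pder_iterate (hf : ContDiff ℝ ∞ f) (i : Fin d) (a : ℕ) :
    ContDiff ℝ ∞ ((_root_.pder i)^[a] f) := by
  induction a with
  | zero => exact hf
  | succ a ih =>
    rw [Function.iterate_succ_apply']
    exact ih.pder i

lemma pder_comm (hf : ContDiff ℝ ∞ f) (i j : Fin d) : pder i (pder j f) = pder j (pder i f) := by
  have hd : Differentiable ℝ (fderiv ℝ f) :=
    (hf.fderiv_right (m := ∞) (by simp)).differentiable (by simp)
  have h : ∀ (i j : Fin d) x, pder i (pder j f) x =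
      fderiv ℝ (fderiv ℝ f) x (Pi.single i 1) (Pi.single j 1) := fun i j x => by
    change fderiv ℝ (fun y => fderiv ℝ f y (Pi.single j 1)) x (Pi.single i 1) = _
    rw [fderiv_clm_apply (hd x) (differentiableAt_const _)]
    simp
  ext x
  rw [h, h]
  exact hf.contDiffAt.isSymmSndFDerivAt
    (by simpa using (mod_cast le_top : ((2 : ℕ∞) : WithTop ℕ∞) ≤ ∞)) _ _

lemma pder_iterate_comm (hf : ContDiff ℝ ∞ f) (i j : Fin d) (a : ℕ) :
    (pder i)^[a] (pder j f) = pder j ((pder i)^[a] f) := by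
  induction a with
  | zero => rfl
  | succ a ih => rw [Function.iterate_succ_apply', ih, pder_comm (hf.pder_iterate i a),
      Function.iterate_succ_apply']

lemma ContDiff.foldr_pder (hf : ContDiff ℝ ∞ f) (μ : Fin d → ℕ) (L : List (Fin d)) :
    ContDiff ℝ ∞ (L.foldr (fun i g => (_root_.pder i)^[μ i] g) f) := by
  induction L with
  | nil => exact hf
  | cons j L ih => exact ih.pder_iterate j _

lemma foldr_pder_pder (hf : ContDiff ℝ ∞ f) (μ : Fin d → ℕ) (i : Fin d) (L : List (Fin d)) :
    L.foldr (fun i g => (pder i)^[μ i] g) (pder i f) =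
      pder i (L.foldr (fun i g => (pder i)^[μ i] g) f) := by
  induction L with
  | nil => rfl
  | cons j L ih =>
    rw [List.foldr_cons, List.foldr_cons, ih, pder_iterate_comm (hf.foldr_pder μ L)]

lemma foldr_pder_add_single (hf : ContDiff ℝ ∞ f) (μ : Fin d → ℕ) (i : Fin d)
    (L : List (Fin d)) (hL : L.Nodup) :
    L.foldr (fun j g => (pder j)^[(μ + Pi.single i 1 : Fin d → ℕ) j] g) f =
      if i ∈ L then pder i (L.foldr (fun j g => (pder j)^[μ j] g) f)
      else L.foldr (fun j g => (pder j)^[μ j] g) f := by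
  induction L with
  | nil => simp
  | cons j L ih =>
    obtain ⟨hj, hL⟩ := List.nodup_cons.1 hL
    rw [List.foldr_cons, ih hL, List.foldr_cons]
    rcases eq_or_ne i j with rfl | hij
    · rw [if_neg hj, if_pos List.mem_cons_self, Pi.add_apply, Pi.single_eq_same,
        Function.iterate_succ_apply']
    · rw [Pi.add_apply, Pi.single_eq_of_ne hij.symm, add_zero]
      by_cases hi : i ∈ L
      · simp [hi, pder_iterate_comm (hf.foldr_pder μ L)]
      · simp [hi, hij]

lemma mder_pder (hf : ContDiff ℝ ∞ f) (μ : Fin d → ℕ) (i : Fin d) :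
    mder μ (pder i f) = mder (μ + Pi.single i 1) f := by
  unfold mder
  rw [foldr_pder_pder hf, foldr_pder_add_single hf _ _ _ (List.nodup_finRange d)]
  simp

lemma mder_zero : mder 0 f = f := by
  unfold mder
  induction List.finRange d with
  | nil => rfl
  | cons j L ih => simp

lemma mOrder_add_single (μ : Fin d → ℕ) (i : Fin d) :
    mOrder (μ + Pi.single i 1) = mOrder μ + 1 := by
  simp [mOrder, Finset.sum_add_distrib]

lemma fderiv_eq_sum_pder (x : Fin d → ℝ) :
    fderiv ℝ f x = ∑ i, ContinuousLinearMap.smulRightL ℝ (Fin d → ℝ) V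
      (ContinuousLinearMap.proj i) (pder i f x) := by
  ext v
  conv_lhs => rw [← Finset.univ_sum_single v, map_sum]
  simp only [sum_apply]
  refine Finset.sum_congr rfl fun i _ => ?_
  have : Pi.single i (v i) = v i • (Pi.single i 1 : Fin d → ℝ) := by
    rw [← Pi.single_smul, smul_eq_mul, mul_one]
  simp [this, pder]

lemma SymbolFamily.of_mder {ι : Type*} {l : Filter ι} {ρ : ℝ} (K : ℕ) {m : ℝ}
    (hf : ContDiff ℝ ∞ f) (h : ∀ μ : Fin d → ℕ, ∃ C : ℝ, ∀ x,
      ‖mder μ f x‖ ≤ C * (1 + ‖x‖ ^ 2) ^ ((m - ρ * mOrder μ) / 2)) :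
    SymbolFamily l K m ρ (fun _ : ι => f) := by
  have h0 : ∃ C : ℝ, ∀ x, ‖f x‖ ≤ C * (1 + ‖x‖ ^ 2) ^ (m / 2) := by
    simpa [mder_zero, mOrder] using h 0
  obtain ⟨C, hC⟩ := h0
  induction K generalizing m f C with
  | zero => exact SymbolFamily.of_norm_le (fun _ => hf) (.of_forall fun _ => hC)
  | succ K ih =>
    refine SymbolFamily.of_fderiv (fun _ => hf) (.of_forall fun _ => hC) ?_
    simp only [funext fun x => fderiv_eq_sum_pder (f := f) x]
    refine SymbolFamily.sum _ fun i => SymbolFamily.clm_comp ?_ _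
    have hi : ∀ μ : Fin d → ℕ, ∃ C : ℝ, ∀ x,
        ‖mder μ (_root_.pder i f) x‖ ≤ C * (1 + ‖x‖ ^ 2) ^ ((m - ρ - ρ * mOrder μ) / 2) := by
      intro μ
      obtain ⟨C, hC⟩ := h (μ + Pi.single i 1)
      refine ⟨C, fun x => ?_⟩
      rw [mder_pder hf]
      refine (hC x).trans_eq ?_
      rw [mOrder_add_single]
      push_cast
      ring_nf
    obtain ⟨D, hD⟩ := hi 0
    exact ih (hf.pder i) hi D (by simpa [mder_zero, mOrder] using hD)

lemma IsSymbol.symbolFamily {ι : Type*} {l : Filter ι} {m ρ : ℝ} (hf : IsSymbol m ρ f) (K : ℕ) :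
    SymbolFamily l K m ρ (fun _ : ι => f) := by
  refine SymbolFamily.of_mder K hf.1 fun μ => ?_
  obtain ⟨C, hC⟩ := hf.2 μ
  refine ⟨C, fun x => ?_⟩
  have hx := hC x
  have hpos : (0 : ℝ) < 1 + ‖x‖ ^ 2 := by positivity
  rw [symWt, neg_div, Real.rpow_neg hpos.le, inv_mul_le_iff₀ (by positivity)] at hx
  linarith

end PartialDerivatives

section IntegrationByParts

variable {ι κ E V : Type*} [Fintype κ] [NormedAddCommGroup E] [NormedSpace ℝ E]
  [NormedAddCommGroup V] [NormedSpace ℝ V] {l : Filter ι} {ℓ : κ → E →L[ℝ] ℝ} {e : κ → E}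

/-- The function `1 + ∑ₖ ℓₖ²`. -/
noncomputable def ellipticWeight (ℓ : κ → E →L[ℝ] ℝ) (z : E) : ℝ := 1 + ∑ k, ℓ k z * ℓ k z

lemma ellipticWeight_pos (z : E) : 0 < ellipticWeight ℓ z := by
  have := Finset.sum_nonneg fun k (_ : k ∈ Finset.univ) => mul_self_nonneg (ℓ k z)
  unfold ellipticWeight
  linarith

lemma contDiff_ellipticWeight : ContDiff ℝ ∞ (ellipticWeight ℓ) :=
  contDiff_const.add (ContDiff.sum fun k _ => (ℓ k).contDiff.mul (ℓ k).contDiff)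

lemma symbolFamily_ellipticWeight_inv {c : ℝ} (hc : 0 < c)
    (hℓ : ∀ z, c * (1 + ‖z‖ ^ 2) ≤ ellipticWeight ℓ z) (K : ℕ) :
    SymbolFamily l K (-2) 1 (fun (_ : ι) z => (ellipticWeight ℓ z)⁻¹) := by
  refine SymbolFamily.inv (fun K => ?_) hc hℓ K
  refine ((SymbolFamily.const 1).of_le le_rfl (by norm_num) le_rfl).add
    (SymbolFamily.sum _ fun k => ?_)
  exact ((SymbolFamily.clm (ℓ k)).smul (SymbolFamily.clm (ℓ k))).of_le le_rfl (by norm_num) le_rfl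

lemma contDiff_weighted {G : E → V} (hG : ContDiff ℝ ∞ G) (k : κ) :
    ContDiff ℝ ∞ (fun y => ℓ k y • ((ellipticWeight ℓ y)⁻¹ • G y)) :=
  (ℓ k).contDiff.smul
    ((contDiff_ellipticWeight.inv fun z => (ellipticWeight_pos z).ne').smul hG)

/-- `F` is a family of compactly supported symbols, uniformly of order `m` and type `ρ`, which
near every point eventually coincides with `f`. -/
structure SymbolApprox (l : Filter ι) (m ρ : ℝ) (F : ι → E → V) (f : E → V) : Prop where
  symbol : ∀ K, SymbolFamily l K m ρ F
  compact : ∀ᶠ a in l, HasCompactSupport (F a)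
  eventuallyEq : ∀ z, ∀ᶠ a in l, F a =ᶠ[𝓝 z] f

variable [NormedSpace ℂ V]

/-- The transpose of `q⁻¹ (1 - i ∑ₖ ℓₖ ∂_{eₖ})`, where `q = 1 + ∑ₖ ℓₖ²`. The operator itself fixes
every function `φ` with `∂_{eₖ} φ = i ℓₖ φ`. -/
noncomputable def transposeOp (ℓ : κ → E →L[ℝ] ℝ) (e : κ → E) (G : E → V) : E → V := fun z =>
  (ellipticWeight ℓ z)⁻¹ • G z +
    Complex.I • ∑ k, fderiv ℝ (fun y => ℓ k y • ((ellipticWeight ℓ y)⁻¹ • G y)) z (e k)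

lemma HasCompactSupport.transposeOp {G : E → V} (hG : HasCompactSupport G) :
    HasCompactSupport (_root_.transposeOp ℓ e G) := by
  refine HasCompactSupport.of_support_subset_isCompact hG fun z hz => ?_
  by_contra hzG
  refine hz ?_
  have h0 : G =ᶠ[𝓝 z] 0 := notMem_tsupport_iff_eventuallyEq.1 hzG
  have hk : ∀ k, fderiv ℝ (fun y => ℓ k y • ((ellipticWeight ℓ y)⁻¹ • G y)) z = 0 := fun k => by
    have : (fun y => ℓ k y • ((ellipticWeight ℓ y)⁻¹ • G y)) =ᶠ[𝓝 z] fun _ => 0 :=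
      h0.mono fun y hy => by simp [hy]
    rw [this.fderiv_eq]
    simp
  simp [_root_.transposeOp, hk, h0.self_of_nhds]

lemma Filter.EventuallyEq.transposeOp {F G : E → V} {z : E} (h : F =ᶠ[𝓝 z] G) :
    _root_.transposeOp ℓ e F =ᶠ[𝓝 z] _root_.transposeOp ℓ e G := by
  filter_upwards [h.eventuallyEq_nhds] with y hy
  have hk : ∀ k, fderiv ℝ (fun y => ℓ k y • ((ellipticWeight ℓ y)⁻¹ • F y)) y =
      fderiv ℝ (fun y => ℓ k y • ((ellipticWeight ℓ y)⁻¹ • G y)) y := fun k =>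
    Filter.EventuallyEq.fderiv_eq (hy.mono fun x hx => by simp [hx])
  simp [_root_.transposeOp, hk, hy.self_of_nhds]

lemma tendsto_integral_of_integrable_order [MeasurableSpace E] [BorelSpace E]
    [FiniteDimensional ℝ E] {ν : Measure E} [ν.IsAddHaarMeasure] {φ : E → ℂ}
    [l.IsCountablyGenerated] (hφ : Continuous φ)
    (hφ1 : ∀ z, ‖φ z‖ ≤ 1) {m ρ : ℝ} (hm : m < -Module.finrank ℝ E) {F : ι → E → V} {f : E → V}
    (h : SymbolApprox l m ρ F f) :
    Tendsto (fun a => ∫ z, φ z • F a z ∂ν) l (𝓝 (∫ z, φ z • f z ∂ν)) := by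
  obtain ⟨C, hC, hb⟩ := (h.symbol 0).2 0 le_rfl
  refine tendsto_integral_filter_of_dominated_convergence
    (fun z => C * (1 + ‖z‖ ^ 2) ^ (-(-m) / 2)) ?_ ?_ ?_ ?_
  · exact .of_forall fun a =>
      (hφ.smul ((h.symbol 0).1 a).continuous).aestronglyMeasurable
  · filter_upwards [hb] with a ha
    refine .of_forall fun z => ?_
    rw [norm_smul]
    refine (mul_le_of_le_one_left (norm_nonneg _) (hφ1 z)).trans ?_
    simpa using ha z
  · exact (integrable_rpow_neg_one_add_norm_sq (by linarith)).const_mul C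
  · refine .of_forall fun z => ?_
    refine tendsto_const_nhds.congr' ((h.eventuallyEq z).mono fun a ha => ?_)
    simp only [ha.self_of_nhds]

variable [IsScalarTower ℝ ℂ V]

lemma SymbolFamily.transposeOp {c : ℝ} (hc : 0 < c)
    (hℓ : ∀ z, c * (1 + ‖z‖ ^ 2) ≤ ellipticWeight ℓ z) {m ρ : ℝ} (hρ : ρ ≤ 1) {F : ι → E → V}
    (hF : ∀ K, SymbolFamily l K m ρ F) (K : ℕ) :
    SymbolFamily l K (m - (1 + ρ)) ρ (fun a => _root_.transposeOp ℓ e (F a)) := by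
  have h1 : ∀ K, SymbolFamily l K (-2 + m) ρ
      (fun a z => (ellipticWeight ℓ z)⁻¹ • F a z) := fun K =>
    ((symbolFamily_ellipticWeight_inv hc hℓ K).of_le le_rfl le_rfl hρ).smul (hF K)
  refine ((h1 K).of_le le_rfl (by linarith) le_rfl).add ?_
  have h2 : ∀ k, SymbolFamily l K (m - (1 + ρ)) ρ (fun a z =>
      _root_.fderiv ℝ (fun y => ℓ k y • ((ellipticWeight ℓ y)⁻¹ • F a y)) z (e k)) := fun k => by
    have := (((SymbolFamily.clm (ℓ k)).of_le le_rfl le_rfl hρ).smul (h1 (K + 1))).fderiv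
    exact (this.of_le le_rfl (by linarith) le_rfl).clm_comp (ContinuousLinearMap.apply ℝ V (e k))
  exact (SymbolFamily.sum Finset.univ h2).clm_comp (Complex.I • ContinuousLinearMap.id ℝ V)

variable [MeasurableSpace E] [BorelSpace E] [FiniteDimensional ℝ E] {ν : Measure E}
  [ν.IsAddHaarMeasure] {φ : E → ℂ}

lemma integral_smul_transposeOp (hφ : ContDiff ℝ ∞ φ)
    (hφe : ∀ k z, fderiv ℝ φ z (e k) = Complex.I * ℓ k z * φ z) {G : E → V}
    (hG : ContDiff ℝ ∞ G) (hGs : HasCompactSupport G) :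
    ∫ z, φ z • transposeOp ℓ e G z ∂ν = ∫ z, φ z • G z ∂ν := by
  set H : κ → E → V := fun k y => ℓ k y • ((ellipticWeight ℓ y)⁻¹ • G y) with hH
  have hHc : ∀ k, ContDiff ℝ ∞ (H k) := contDiff_weighted hG
  have hHs : ∀ k, HasCompactSupport (H k) := fun k =>
    (hGs.smul_left (f := fun y => (ellipticWeight ℓ y)⁻¹)).smul_left (f := ℓ k)
  have hqc : Continuous fun z => (ellipticWeight ℓ z)⁻¹ • G z :=
    (contDiff_ellipticWeight.continuous.inv₀ fun z => (ellipticWeight_pos z).ne').smul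
      hG.continuous
  have hqs : HasCompactSupport fun z => (ellipticWeight ℓ z)⁻¹ • G z :=
    hGs.smul_left (f := fun y => (ellipticWeight ℓ y)⁻¹)
  have i0 : Integrable (fun z => φ z • ((ellipticWeight ℓ z)⁻¹ • G z)) ν :=
    (hφ.continuous.smul hqc).integrable_of_hasCompactSupport (hqs.smul_left (f := φ))
  have hdc : ∀ k, Continuous fun z => fderiv ℝ (H k) z (e k) := fun k =>
    ((hHc k).continuous_fderiv (by simp)).clm_apply continuous_const
  have hds : ∀ k, HasCompactSupport fun z => fderiv ℝ (H k) z (e k) := fun k =>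
    (hHs k).fderiv_apply ℝ (e k)
  have i1 : ∀ k, Integrable (fun z => φ z • fderiv ℝ (H k) z (e k)) ν := fun k =>
    (hφ.continuous.smul (hdc k)).integrable_of_hasCompactSupport ((hds k).smul_left (f := φ))
  have hφd : ∀ k, Continuous fun z => fderiv ℝ φ z (e k) := fun k =>
    (hφ.continuous_fderiv (by simp)).clm_apply continuous_const
  have i2 : ∀ k, Integrable (fun z => fderiv ℝ φ z (e k) • H k z) ν := fun k =>
    ((hφd k).smul (hHc k).continuous).integrable_of_hasCompactSupport
      ((hHs k).smul_left (f := fun z => fderiv ℝ φ z (e k)))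
  have i3 : ∀ k, Integrable (fun z => φ z • H k z) ν := fun k =>
    (hφ.continuous.smul (hHc k).continuous).integrable_of_hasCompactSupport
      ((hHs k).smul_left (f := φ))
  have ibp : ∀ k, ∫ z, φ z • fderiv ℝ (H k) z (e k) ∂ν = -∫ z, fderiv ℝ φ z (e k) • H k z ∂ν :=
    fun k => integral_smul_fderiv_eq_neg_fderiv_smul_of_integrable (i2 k) (i1 k) (i3 k)
      (fun z _ => hφ.differentiable (by simp) z) (fun z _ => (hHc k).differentiable (by simp) z)
  have hL : ∀ z, φ z • transposeOp ℓ e G z = φ z • ((ellipticWeight ℓ z)⁻¹ • G z) +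
      Complex.I • ∑ k, φ z • fderiv ℝ (H k) z (e k) := fun z => by
    rw [transposeOp, smul_add, smul_comm (φ z) Complex.I, Finset.smul_sum]
  have hcoe : ∀ (r : ℝ) (v : V), r • v = (r : ℂ) • v := fun r v => (algebraMap_smul ℂ r v).symm
  have hR : ∀ z, φ z • G z = φ z • ((ellipticWeight ℓ z)⁻¹ • G z) -
      Complex.I • ∑ k, fderiv ℝ φ z (e k) • H k z := fun z => by
    have hq := (ellipticWeight_pos (ℓ := ℓ) z).ne'
    have hk : ∀ k, fderiv ℝ φ z (e k) • H k z =
        (Complex.I * φ z * (((ℓ k z * ℓ k z : ℝ) : ℂ)) * ((ellipticWeight ℓ z)⁻¹ : ℝ)) • G z :=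
      fun k => by
        simp only [hH, hφe, hcoe, smul_smul]
        congr 1
        push_cast
        ring
    simp only [hk, ← Finset.sum_smul, ← Finset.sum_mul, ← Finset.mul_sum, ← Complex.ofReal_sum]
    have hs : ∑ k, ℓ k z * ℓ k z = ellipticWeight ℓ z - 1 := by simp [ellipticWeight]
    rw [hs, hcoe, smul_smul, smul_smul, ← sub_smul]
    congr 1
    have hq' : (ellipticWeight ℓ z : ℂ) ≠ 0 := by exact_mod_cast hq
    push_cast
    field_simp
    linear_combination (φ z * (ellipticWeight ℓ z - 1)) * Complex.I_sq
  simp_rw [hL, hR]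
  rw [integral_add i0 ((integrable_finsetSum _ fun k _ => i1 k).fun_smul Complex.I),
    integral_sub i0 ((integrable_finsetSum _ fun k _ => i2 k).fun_smul Complex.I),
    integral_smul, integral_smul, integral_finsetSum _ fun k _ => i1 k,
    integral_finsetSum _ fun k _ => i2 k]
  simp only [ibp, Finset.sum_neg_distrib, smul_neg, sub_eq_add_neg]

lemma exists_tendsto_integral_of_symbolApprox [l.IsCountablyGenerated] (hφ : ContDiff ℝ ∞ φ)
    (hφ1 : ∀ z, ‖φ z‖ ≤ 1) (hφe : ∀ k z, fderiv ℝ φ z (e k) = Complex.I * ℓ k z * φ z)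
    {c : ℝ} (hc : 0 < c) (hℓ : ∀ z, c * (1 + ‖z‖ ^ 2) ≤ ellipticWeight ℓ z)
    {m ρ : ℝ} (hρ1 : -1 < ρ) (hρ2 : ρ ≤ 1) (f : E → V) :
    ∃ v, ∀ F : ι → E → V, SymbolApprox l m ρ F f →
      Tendsto (fun a => ∫ z, φ z • F a z ∂ν) l (𝓝 v) := by
  obtain ⟨N, hN⟩ := exists_nat_gt ((m + Module.finrank ℝ E) / (1 + ρ))
  rw [div_lt_iff₀ (by linarith)] at hN
  induction N generalizing m f with
  | zero =>
    exact ⟨_, fun F hF => tendsto_integral_of_integrable_order hφ.continuous hφ1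
      (by simp at hN; linarith) hF⟩
  | succ N ih =>
    obtain ⟨v, hv⟩ := ih (m := m - (1 + ρ)) (transposeOp ℓ e f)
      (by push_cast at hN; linarith)
    refine ⟨v, fun F hF => ?_⟩
    refine (hv (fun a => transposeOp ℓ e (F a))
      ⟨SymbolFamily.transposeOp hc hℓ hρ2 hF.symbol, hF.compact.mono fun a ha => ha.transposeOp,
        fun z => (hF.eventuallyEq z).mono fun a ha => ha.transposeOp⟩).congr' ?_
    filter_upwards [hF.compact] with a ha
    exact integral_smul_transposeOp hφ hφe ((hF.symbol 0).1 a) ha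

end IntegrationByParts

section Cutoffs

variable {E : Type*} [NormedAddCommGroup E] [NormedSpace ℝ E] {χ : E → ℝ}

lemma one_add_norm_sq_rpow_half_le {ε : ℝ} (h0 : 0 ≤ ε) (h1 : ε ≤ 1) (z z₀ : E) :
    ε * (1 + ‖z‖ ^ 2) ^ (1 / 2 : ℝ) ≤ 1 + ‖z₀‖ + ‖ε • (z - z₀)‖ := by
  have h2 : (1 + ‖z‖ ^ 2) ^ (1 / 2 : ℝ) ≤ 1 + ‖z‖ := by
    rw [← Real.sqrt_eq_rpow, Real.sqrt_le_left (by positivity)]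
    nlinarith [norm_nonneg z]
  have h3 : ‖z‖ ≤ ‖z₀‖ + ‖z - z₀‖ := by
    simpa using norm_add_le z₀ (z - z₀)
  rw [norm_smul, Real.norm_of_nonneg h0]
  nlinarith [norm_nonneg z₀]

lemma symbolFamily_cutoff (hχ : ContDiff ℝ ∞ χ) (hs : HasCompactSupport χ) (z₀ : E) (K : ℕ) :
    SymbolFamily (𝓝[>] (0 : ℝ)) K 0 1 (fun ε z => χ (ε • (z - z₀))) := by
  refine ⟨fun ε => hχ.comp (contDiff_const.smul (contDiff_id.sub contDiff_const)),
    fun k _ => ?_⟩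
  have hk : ContDiff ℝ k χ := hχ.of_le (mod_cast le_top)
  have hcont : Continuous fun y => (1 + ‖z₀‖ + ‖y‖) ^ k • iteratedFDeriv ℝ k χ y :=
    ((continuous_const.add continuous_norm).pow k).smul (hk.continuous_iteratedFDeriv le_rfl)
  obtain ⟨C, hC⟩ := (HasCompactSupport.smul_left (f := fun y => (1 + ‖z₀‖ + ‖y‖) ^ k)
    (hs.iteratedFDeriv k)).exists_bound_of_continuous hcont
  refine ⟨C, (norm_nonneg _).trans (hC 0), ?_⟩
  filter_upwards [Ioc_mem_nhdsGT (zero_lt_one' ℝ)] with ε hε z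
  have hpos : (0 : ℝ) < 1 + ‖z‖ ^ 2 := by positivity
  have e : iteratedFDeriv ℝ k (fun z => χ (ε • (z - z₀))) z =
      ε ^ k • iteratedFDeriv ℝ k χ (ε • (z - z₀)) := by
    rw [iteratedFDeriv_comp_sub (f := fun y => χ (ε • y)) k z₀ z,
      iteratedFDeriv_comp_const_smul ε hk]
  have hexp : (1 + ‖z‖ ^ 2) ^ ((0 - 1 * (k : ℝ)) / 2) =
      (((1 + ‖z‖ ^ 2) ^ (1 / 2 : ℝ)) ^ k)⁻¹ := by
    rw [← Real.rpow_natCast ((1 + ‖z‖ ^ 2) ^ (1 / 2 : ℝ)) k, ← Real.rpow_mul hpos.le,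
      ← Real.rpow_neg hpos.le]
    congr 1
    ring
  rw [e, norm_smul, norm_pow, Real.norm_of_nonneg hε.1.le, hexp, ← div_eq_mul_inv,
    le_div_iff₀ (by positivity)]
  have hy : ‖(1 + ‖z₀‖ + ‖ε • (z - z₀)‖) ^ k • iteratedFDeriv ℝ k χ (ε • (z - z₀))‖ ≤ C :=
    hC (ε • (z - z₀))
  rw [norm_smul, norm_pow, Real.norm_of_nonneg (by positivity)] at hy
  refine le_trans ?_ hy
  calc _ = (ε * (1 + ‖z‖ ^ 2) ^ (1 / 2 : ℝ)) ^ k *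
        ‖iteratedFDeriv ℝ k χ (ε • (z - z₀))‖ := by rw [mul_pow]; ring
    _ ≤ _ := by
        have := hε.1.le
        gcongr
        exact one_add_norm_sq_rpow_half_le hε.1.le hε.2 z z₀

lemma hasCompactSupport_cutoff (hs : HasCompactSupport χ) (z₀ : E) {ε : ℝ} (hε : ε ≠ 0) :
    HasCompactSupport fun z => χ (ε • (z - z₀)) :=
  hs.comp_homeomorph ((Homeomorph.subRight z₀).trans (Homeomorph.smulOfNeZero ε hε))

lemma eventually_cutoff_eq_one (h1 : ∀ᶠ z in 𝓝 (0 : E), χ z = 1) (z₀ z : E) :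
    ∀ᶠ ε in 𝓝[>] (0 : ℝ), ∀ᶠ y in 𝓝 z, χ (ε • (y - z₀)) = 1 := by
  have hc : Tendsto (fun p : ℝ × E => p.1 • (p.2 - z₀)) (𝓝 0 ×ˢ 𝓝 z) (𝓝 0) := by
    have : Continuous fun p : ℝ × E => p.1 • (p.2 - z₀) := by fun_prop
    simpa [nhds_prod_eq] using this.tendsto (0, z)
  exact ((hc.eventually h1).curry).filter_mono nhdsWithin_le_nhds

lemma symbolApprox_cutoff {V : Type*} [NormedAddCommGroup V] [NormedSpace ℝ V] {m ρ : ℝ}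
    (hρ : ρ ≤ 1) {F : E → V} (hF : ∀ K, SymbolFamily (𝓝[>] (0 : ℝ)) K m ρ fun _ => F)
    (hχ : ContDiff ℝ ∞ χ) (hs : HasCompactSupport χ) (h1 : ∀ᶠ z in 𝓝 (0 : E), χ z = 1) (z₀ : E) :
    SymbolApprox (𝓝[>] (0 : ℝ)) m ρ (fun ε z => χ (ε • (z - z₀)) • F z) F where
  symbol K := (((symbolFamily_cutoff hχ hs z₀ K).of_le le_rfl le_rfl hρ).smul (hF K)).of_le le_rfl
    (zero_add m).le le_rfl
  compact := by
    filter_upwards [self_mem_nhdsWithin] with ε hε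
    exact (hasCompactSupport_cutoff hs z₀ (ne_of_gt hε)).smul_right
  eventuallyEq z := (eventually_cutoff_eq_one h1 z₀ z).mono fun ε hε =>
    hε.mono fun y hy => by simp [hy]

end Cutoffs

section Phase

variable {n : ℕ} (M : Matrix (Fin n) (Fin n) ℝ)

/-- The differential at `v` of the quadratic form `z ↦ pairM M (fstHalf z) (sndHalf z)`. -/
noncomputable def phaseGrad (v : Fin (n + n) → ℝ) : (Fin (n + n) → ℝ) →L[ℝ] ℝ :=
  ∑ i, ∑ j, M i j • (v (Fin.castAdd n i) • ContinuousLinearMap.proj (Fin.natAdd n j) +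
    v (Fin.natAdd n j) • ContinuousLinearMap.proj (Fin.castAdd n i))

lemma phaseGrad_apply (v z : Fin (n + n) → ℝ) : phaseGrad M v z = ∑ i, ∑ j, M i j *
    (v (Fin.castAdd n i) * z (Fin.natAdd n j) + v (Fin.natAdd n j) * z (Fin.castAdd n i)) := by
  simp [phaseGrad, mul_add]

lemma phaseGrad_comm (v z : Fin (n + n) → ℝ) : phaseGrad M v z = phaseGrad M z v := by
  simp only [phaseGrad_apply]
  exact Finset.sum_congr rfl fun i _ => Finset.sum_congr rfl fun j _ => by ring

lemma pairM_fstHalf_sndHalf (z : Fin (n + n) → ℝ) : pairM M (fstHalf z) (sndHalf z) =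
    ∑ i, ∑ j, M i j * (z (Fin.castAdd n i) * z (Fin.natAdd n j)) := by
  simp only [pairM, fstHalf, sndHalf, Matrix.mulVec, dotProduct, Finset.mul_sum]
  exact Finset.sum_congr rfl fun i _ => Finset.sum_congr rfl fun j _ => by ring

lemma hasFDerivAt_pairM (z : Fin (n + n) → ℝ) :
    HasFDerivAt (fun z => pairM M (fstHalf z) (sndHalf z)) (phaseGrad M z) z := by
  simp only [pairM_fstHalf_sndHalf]
  refine HasFDerivAt.fun_sum fun i _ => HasFDerivAt.fun_sum fun j _ => ?_
  exact ((hasFDerivAt_apply (𝕜 := ℝ) (Fin.castAdd n i) z).mul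
    (hasFDerivAt_apply (𝕜 := ℝ) (Fin.natAdd n j) z)).const_mul (M i j)

lemma contDiff_phase : ContDiff ℝ ∞ (phase M) := by
  have h : ContDiff ℝ ∞ fun z : Fin (n + n) → ℝ => pairM M (fstHalf z) (sndHalf z) := by
    simp only [pairM_fstHalf_sndHalf]
    refine ContDiff.sum fun i _ => ContDiff.sum fun j _ => ?_
    fun_prop
  exact (contDiff_const.mul (Complex.ofRealCLM.contDiff.comp h)).cexp

lemma norm_phase (z : Fin (n + n) → ℝ) : ‖phase M z‖ = 1 := by
  rw [phase, mul_comm, Complex.norm_exp_ofReal_mul_I]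

lemma fderiv_phase (z v : Fin (n + n) → ℝ) :
    fderiv ℝ (phase M) z v = Complex.I * phaseGrad M v z * phase M z := by
  have h : HasFDerivAt (phase M) _ z :=
    ((Complex.ofRealCLM.hasFDerivAt.comp z (hasFDerivAt_pairM M z)).const_mul Complex.I).cexp
  rw [h.fderiv, phaseGrad_comm M v z]
  simp [phase]
  ring

variable {M}

lemma eq_zero_of_phaseGrad_single (hM : M.det ≠ 0) {z : Fin (n + n) → ℝ}
    (h : ∀ k, phaseGrad M (Pi.single k 1) z = 0) : z = 0 := by
  have hne (i j : Fin n) : Fin.natAdd n j ≠ Fin.castAdd n i := by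
    simp only [ne_eq, Fin.ext_iff, Fin.val_natAdd, Fin.val_castAdd]
    lia
  have hx : sndHalf z = 0 := by
    refine Matrix.eq_zero_of_mulVec_eq_zero hM (funext fun i => ?_)
    rw [Pi.zero_apply, ← h (Fin.castAdd n i), phaseGrad_apply]
    simp [Pi.single_apply, Matrix.mulVec, dotProduct, sndHalf, hne, -Fin.natAdd_eq_addNat]
  have hp : fstHalf z = 0 := by
    refine Matrix.eq_zero_of_vecMul_eq_zero hM (funext fun j => ?_)
    rw [Pi.zero_apply, ← h (Fin.natAdd n j), phaseGrad_apply]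
    simp [Pi.single_apply, Matrix.vecMul, dotProduct, fstHalf, fun i j => (hne i j).symm, mul_comm,
      -Fin.natAdd_eq_addNat]
  ext k
  induction k using Fin.addCases with
  | left i => exact congrFun hp i
  | right j => exact congrFun hx j

lemma exists_le_ellipticWeight_phaseGrad (hM : M.det ≠ 0) : ∃ c : ℝ, 0 < c ∧ ∀ z,
    c * (1 + ‖z‖ ^ 2) ≤ ellipticWeight (fun k => phaseGrad M (Pi.single k 1)) z := by
  let T : (Fin (n + n) → ℝ) →ₗ[ℝ] (Fin (n + n) → ℝ) :=
    LinearMap.pi fun k => (phaseGrad M (Pi.single k 1)).toLinearMap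
  obtain ⟨K, -, hK⟩ := T.exists_antilipschitzWith <| LinearMap.ker_eq_bot'.2 fun z hz =>
    eq_zero_of_phaseGrad_single hM fun k => congrFun hz k
  refine ⟨(1 + (K : ℝ) ^ 2)⁻¹, by positivity, fun z => ?_⟩
  rw [inv_mul_le_iff₀ (by positivity), ellipticWeight]
  set S := ∑ k, phaseGrad M (Pi.single k 1) z * phaseGrad M (Pi.single k 1) z
  have hS : 0 ≤ S := Finset.sum_nonneg fun k _ => mul_self_nonneg _
  have hT : ‖T z‖ ≤ √S := (pi_norm_le_iff_of_nonneg (Real.sqrt_nonneg S)).2 fun k =>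
    Real.abs_le_sqrt <| (pow_two _).trans_le <| Finset.single_le_sum
      (f := fun k => phaseGrad M (Pi.single k 1) z * phaseGrad M (Pi.single k 1) z)
      (fun k _ => mul_self_nonneg _) (Finset.mem_univ k)
  have hz : ‖z‖ ≤ K * √S := by
    have := hK.le_mul_dist z 0
    simp only [map_zero, dist_zero_right] at this
    exact this.trans (by gcongr)
  have hz2 : ‖z‖ ^ 2 ≤ (K : ℝ) ^ 2 * S := by
    calc ‖z‖ ^ 2 ≤ (K * √S) ^ 2 := by gcongr
      _ = _ := by rw [mul_pow, Real.sq_sqrt hS]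
  nlinarith [sq_nonneg (K : ℝ)]

end Phase

theorem statement11 {n : ℕ} {V : Type*} [NormedAddCommGroup V] [NormedSpace ℝ V]
    [NormedSpace ℂ V] [IsScalarTower ℝ ℂ V] [CompleteSpace V]
    (M : Matrix (Fin n) (Fin n) ℝ) (hM : |M.det| = 1)
    (m ρ : ℝ) (hρ1 : -1 < ρ) (hρ2 : ρ ≤ 1)
    (F : (Fin (n + n) → ℝ) → V) (hF : IsSymbol m ρ F) :
    ∃! v : V, IsOscInt M F v := by
  have hdet : M.det ≠ 0 := fun h => by simp [h] at hM
  obtain ⟨c, hc, hℓ⟩ := exists_le_ellipticWeight_phaseGrad hdet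
  obtain ⟨v, hv⟩ := exists_tendsto_integral_of_symbolApprox (ν := volume)
    (l := 𝓝[>] (0 : ℝ)) (e := fun k => Pi.single k 1) (contDiff_phase M)
    (fun z => (norm_phase M z).le) (fun k z => fderiv_phase M z (Pi.single k 1)) hc hℓ
    (m := m) hρ1 hρ2 F
  have hosc : IsOscInt M F (((2 * Real.pi) ^ n)⁻¹ • v) := fun χ hχ hs h1 z₀ => by
    simp only [cutInt, smul_comm (χ _) (phase M _)]
    exact (hv _ (symbolApprox_cutoff hρ2 (fun K => hF.symbolFamily K) hχ hs h1 z₀)).const_smul _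
  refine ⟨_, hosc, fun w hw => ?_⟩
  let χ : ContDiffBump (0 : Fin (n + n) → ℝ) := default
  exact tendsto_nhds_unique (hw χ χ.contDiff χ.hasCompactSupport χ.eventuallyEq_one 0)
    (hosc χ χ.contDiff χ.hasCompactSupport χ.eventuallyEq_one 0)
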